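/- arXiv:1509.02806 — 3 statements merged into one kernel-verified Lean document; each statement's English description precedes it below -/
import Mathlib

section
/- (Proposition 2, entanglement criterion.) Let n ≥ 2 and let ψ ∈ ℂ^{2^n} be a unit vector. If ψ is a product state, i.e. there exist n₁, n₂ ≥ 1 with n₁ + n₂ = n and vectors φ₁ ∈ ℂ^{2^{n₁}}, φ₂ ∈ ℂ^{2^{n₂}} with ψ = φ₁ ⊗ φ₂, then F(ψ) = 0. -/
open Matrix Complex BigOperators

noncomputable section

/-- Cast a square complex matrix along an equality of sizes. -/
def matCast {a b : ℕ} (h : a = b) (A : Matrix (Fin a) (Fin a) ℂ) :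
    Matrix (Fin b) (Fin b) ℂ :=
  Matrix.reindex (finCongr h) (finCongr h) A

/-- Kronecker product of square complex matrices, with indices flattened. -/
def kron {a b : ℕ} (A : Matrix (Fin a) (Fin a) ℂ) (B : Matrix (Fin b) (Fin b) ℂ) :
    Matrix (Fin (a * b)) (Fin (a * b)) ℂ :=
  Matrix.reindex finProdFinEquiv finProdFinEquiv (Matrix.kroneckerMap (· * ·) A B)

/-- Kronecker product of (flattened) vectors. -/
def vkron {a b : ℕ} (u : Fin a → ℂ) (v : Fin b → ℂ) : Fin (a * b) → ℂ :=
  fun i => u (finProdFinEquiv.symm i).1 * v (finProdFinEquiv.symm i).2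

/-- Cast a complex vector along an equality of sizes. -/
def vecCast {a b : ℕ} (h : a = b) (v : Fin a → ℂ) : Fin b → ℂ :=
  fun i => v ((finCongr h).symm i)

def σx : Matrix (Fin 2) (Fin 2) ℂ := !![0, 1; 1, 0]
def σy : Matrix (Fin 2) (Fin 2) ℂ := !![0, -Complex.I; Complex.I, 0]
def σz : Matrix (Fin 2) (Fin 2) ℂ := !![1, 0; 0, -1]
def projL : Matrix (Fin 2) (Fin 2) ℂ := !![1, 0; 0, 0]
def projR : Matrix (Fin 2) (Fin 2) ℂ := !![0, 0; 0, 1]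
def H2 : Matrix (Fin 2) (Fin 2) ℂ := (1 / (Real.sqrt 2 : ℂ)) • !![1, 1; 1, -1]

/-- `k`-fold Kronecker power of a 2×2 matrix. -/
def kpow (A : Matrix (Fin 2) (Fin 2) ℂ) : (k : ℕ) → Matrix (Fin (2 ^ k)) (Fin (2 ^ k)) ℂ
  | 0 => 1
  | k + 1 => matCast (by rw [pow_succ, Nat.mul_comm]) (kron A (kpow A k))

/-- `M_{2^n} := σ_y ⊗ I_{2^{n-2}} ⊗ σ_y` (only meaningful for `n ≥ 2`). -/
def Mmat : (n : ℕ) → Matrix (Fin (2 ^ n)) (Fin (2 ^ n)) ℂ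
  | 0 => 1
  | 1 => 1
  | m + 2 =>
      matCast (by ring)
        (kron σy (kron (1 : Matrix (Fin (2 ^ m)) (Fin (2 ^ m)) ℂ) σy))

/-- `F(ψ) = ⟨ψ| M_{2^n} K |ψ⟩ = Σ_{i,j} conj(ψ_i) (M_{2^n})_{ij} conj(ψ_j)`. -/
def Fval (n : ℕ) (ψ : Fin (2 ^ n) → ℂ) : ℂ :=
  ∑ i, ∑ j, (starRingEnd ℂ) (ψ i) * Mmat n i j * (starRingEnd ℂ) (ψ j)

/-- generalized CNOT gate: `L ⊗ I_{2^{n-1}} + R ⊗ σ_x^{⊗(n-1)}`. -/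
def CNOT : (n : ℕ) → Matrix (Fin (2 ^ n)) (Fin (2 ^ n)) ℂ
  | 0 => 1
  | m + 1 =>
      matCast (by rw [pow_succ, Nat.mul_comm])
        (kron projL (1 : Matrix (Fin (2 ^ m)) (Fin (2 ^ m)) ℂ)) +
      matCast (by rw [pow_succ, Nat.mul_comm]) (kron projR (kpow σx m))

/-- Bell matrix: `B_{2^n} := CNOT_{2^n} (H_{2^{n-1}} ⊗ I₂)`. -/
def Bmat : (n : ℕ) → Matrix (Fin (2 ^ n)) (Fin (2 ^ n)) ℂ
  | 0 => 1
  | m + 1 =>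
      CNOT (m + 1) *
        matCast (by rw [pow_succ]) (kron (kpow H2 m) (1 : Matrix (Fin 2) (Fin 2) ℂ))

/-- `L_{2^n} := B_{2^n}† M_{2^n} B_{2^n}`. -/
def Lmat (n : ℕ) : Matrix (Fin (2 ^ n)) (Fin (2 ^ n)) ℂ :=
  (Bmat n)ᴴ * Mmat n * Bmat n

/-- The GHZ state `(1/√2)(|0…0⟩ + |1…1⟩)` as a vector in `ℂ^{2^n}`. -/
def GHZ (n : ℕ) : Fin (2 ^ n) → ℂ :=
  fun i => if (i : ℕ) = 0 ∨ (i : ℕ) = 2 ^ n - 1 then (1 / (Real.sqrt 2 : ℂ)) else 0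

/-- A state `ψ : Fin (2^n) → ℂ`, viewed as a function `(Fin n → Fin 2) → ℂ`. -/
def toQubits {n : ℕ} (ψ : Fin (2 ^ n) → ℂ) : (Fin n → Fin 2) → ℂ :=
  fun f => ψ (finFunctionFinEquiv f)

/-- Reduced density matrix of qubit `j` of the state `ψ`. -/
def rho {n : ℕ} (ψ : Fin (2 ^ n) → ℂ) (j : Fin n) : Matrix (Fin 2) (Fin 2) ℂ :=
  Matrix.of fun a b =>
    ∑ f : Fin n → Fin 2,
      if f j = 0 then
        toQubits ψ (Function.update f j a) * (starRingEnd ℂ) (toQubits ψ (Function.update f j b))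
      else 0

/-- Meyer–Wallach measure `Q(ψ) = 2(1 - (1/n) Σ_j Tr[ρ_j²])`. -/
def Qmeasure {n : ℕ} (ψ : Fin (2 ^ n) → ℂ) : ℂ :=
  2 * (1 - (1 / (n : ℂ)) * ∑ j : Fin n, Matrix.trace (rho ψ j * rho ψ j))

/-- The Thue–Morse sequence, specified by its recursion (1-indexed). -/
def IsThueMorse (τ : ℕ → ℕ) : Prop :=
  τ 1 = 0 ∧ (∀ n, 1 ≤ n → τ (2 * n) = 1 - τ n) ∧ (∀ n, 1 ≤ n → τ (2 * n - 1) = τ n)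

theorem kron_finProdFinEquiv {a b : ℕ} (A : Matrix (Fin a) (Fin a) ℂ)
    (B : Matrix (Fin b) (Fin b) ℂ) (i i' : Fin a) (j j' : Fin b) :
    kron A B (finProdFinEquiv (i, j)) (finProdFinEquiv (i', j')) = A i i' * B j j' := by
  simp [kron, Matrix.reindex_apply]

theorem matCast_finCongr {a b : ℕ} (h : a = b) (A : Matrix (Fin a) (Fin a) ℂ) (i j : Fin a) :
    matCast h A (finCongr h i) (finCongr h j) = A i j := by
  subst h
  simp [matCast]

theorem vecCast_finCongr {a b : ℕ} (h : a = b) (v : Fin a → ℂ) (i : Fin a) :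
    vecCast h v (finCongr h i) = v i := by
  subst h
  simp [vecCast]

theorem vkron_finProdFinEquiv {a b : ℕ} (u : Fin a → ℂ) (v : Fin b → ℂ) (i : Fin a) (j : Fin b) :
    vkron u v (finProdFinEquiv (i, j)) = u i * v j := by
  simp [vkron]

theorem σy_antisymm (a b : Fin 2) : σy a b = -σy b a := by
  fin_cases a <;> fin_cases b <;> simp [σy]

/-- The index of a basis state of `n = n₁ + n₂` qubits, from indices of its two parts. -/
def bipartiteEquiv {n₁ n₂ n : ℕ} (h : 2 ^ n₁ * 2 ^ n₂ = 2 ^ n) :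
    Fin (2 ^ n₁) × Fin (2 ^ n₂) ≃ Fin (2 ^ n) :=
  finProdFinEquiv.trans (finCongr h)

/-- The index of a basis state of `m + 2` qubits, from its first, middle and last parts. -/
def outerEquiv (m : ℕ) : Fin 2 × Fin (2 ^ m) × Fin 2 ≃ Fin (2 ^ (m + 2)) :=
  ((Equiv.refl _).prodCongr finProdFinEquiv).trans
    (finProdFinEquiv.trans (finCongr (by ring)))

theorem Mmat_outerEquiv (m : ℕ) (a a' b b' : Fin 2) (r r' : Fin (2 ^ m)) :
    Mmat (m + 2) (outerEquiv m (a, r, b)) (outerEquiv m (a', r', b')) =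
      σy a a' * ((1 : Matrix (Fin (2 ^ m)) (Fin (2 ^ m)) ℂ) r r' * σy b b') := by
  rw [← kron_finProdFinEquiv, ← kron_finProdFinEquiv]
  exact matCast_finCongr _ _ _ _

theorem bipartiteEquiv_eq_outerEquiv {p q : ℕ}
    (h : 2 ^ (p + 1) * 2 ^ (q + 1) = 2 ^ (p + q + 2))
    (a b : Fin 2) (r : Fin (2 ^ p)) (s : Fin (2 ^ q)) :
    bipartiteEquiv h (finCongr (pow_succ' 2 p).symm (finProdFinEquiv (a, r)),
        finCongr (pow_succ 2 q).symm (finProdFinEquiv (s, b))) =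
      outerEquiv (p + q) (a, finCongr (pow_add 2 p q).symm (finProdFinEquiv (r, s)), b) := by
  ext
  simp [bipartiteEquiv, outerEquiv, finProdFinEquiv]
  ring

/-- Exchanging the first parts of the row and column indices negates `Mmat`. -/
theorem Mmat_bipartiteEquiv_swap {p q : ℕ}
    (h : 2 ^ (p + 1) * 2 ^ (q + 1) = 2 ^ (p + q + 2))
    (i i' : Fin (2 ^ (p + 1))) (j j' : Fin (2 ^ (q + 1))) :
    Mmat (p + q + 2) (bipartiteEquiv h (i, j)) (bipartiteEquiv h (i', j')) =
      -Mmat (p + q + 2) (bipartiteEquiv h (i', j)) (bipartiteEquiv h (i, j')) := by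
  obtain ⟨⟨a, r⟩, rfl⟩ := (finProdFinEquiv.trans (finCongr (pow_succ' 2 p).symm)).surjective i
  obtain ⟨⟨a', r'⟩, rfl⟩ := (finProdFinEquiv.trans (finCongr (pow_succ' 2 p).symm)).surjective i'
  obtain ⟨⟨s, b⟩, rfl⟩ := (finProdFinEquiv.trans (finCongr (pow_succ 2 q).symm)).surjective j
  obtain ⟨⟨s', b'⟩, rfl⟩ := (finProdFinEquiv.trans (finCongr (pow_succ 2 q).symm)).surjective j'
  simp only [Equiv.trans_apply, bipartiteEquiv_eq_outerEquiv, Mmat_outerEquiv, Matrix.one_apply,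
    EmbeddingLike.apply_eq_iff_eq, Prod.mk.injEq]
  rw [σy_antisymm a a']
  simp only [eq_comm (a := r)]
  ring

theorem sum_eq_zero_of_swap_fst {α β : Type*} [Fintype α] [Fintype β] (f : α × β → α × β → ℂ)
    (hf : ∀ a a' b b', f (a, b) (a', b') = -f (a', b) (a, b')) :
    ∑ x, ∑ y, f x y = 0 := by
  rw [← Fintype.sum_prod_type']
  refine Finset.sum_involution (fun z _ => ((z.2.1, z.1.2), (z.1.1, z.2.2))) ?_ ?_
    (fun _ _ => Finset.mem_univ _) (fun _ _ => rfl)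
  · rintro ⟨⟨a, b⟩, a', b'⟩ -
    simp [hf a a' b b']
  · rintro ⟨⟨a, b⟩, a', b'⟩ - hne heq
    simp only [Prod.mk.injEq, and_true] at heq
    obtain ⟨rfl, -⟩ := heq
    exact hne (self_eq_neg.mp (hf _ _ _ _))

/-- Proposition 2 (entanglement criterion): if a unit state `ψ ∈ ℂ^{2^n}` is a
product state `φ₁ ⊗ φ₂`, then `F(ψ) = 0`. -/
theorem Fval_eq_zero_of_product
    (n n₁ n₂ : ℕ) (hn : 2 ≤ n) (h₁ : 1 ≤ n₁) (h₂ : 1 ≤ n₂) (hsum : n₁ + n₂ = n)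
    (ψ : Fin (2 ^ n) → ℂ) (hunit : ∑ i, ‖ψ i‖ ^ 2 = 1)
    (φ₁ : Fin (2 ^ n₁) → ℂ) (φ₂ : Fin (2 ^ n₂) → ℂ)
    (hprod : ψ = vecCast (show 2 ^ n₁ * 2 ^ n₂ = 2 ^ n by rw [← pow_add, hsum])
        (vkron φ₁ φ₂)) :
    Fval n ψ = 0 := by
  obtain ⟨p, rfl⟩ := Nat.exists_eq_add_of_le' h₁
  obtain ⟨q, rfl⟩ := Nat.exists_eq_add_of_le' h₂
  obtain rfl : n = p + q + 2 := by omega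
  have h : 2 ^ (p + 1) * 2 ^ (q + 1) = 2 ^ (p + q + 2) := by ring
  have hψ (i j) : ψ (bipartiteEquiv h (i, j)) = φ₁ i * φ₂ j := by
    rw [hprod, ← vkron_finProdFinEquiv]
    exact vecCast_finCongr _ _ _
  unfold Fval
  rw [← (bipartiteEquiv h).sum_comp]
  simp_rw [← (bipartiteEquiv h).sum_comp (fun j => _ * Mmat _ _ j * _)]
  refine sum_eq_zero_of_swap_fst _ fun i i' j j' => ?_
  rw [Mmat_bipartiteEquiv_swap]
  simp only [hψ, map_mul]
  ring

end
end

section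
/- For every n ≥ 2, the Greenberger–Horne–Zeilinger state GHZ_n is globally entangled: there are no n₁, n₂ ≥ 1 with n₁ + n₂ = n and vectors φ₁ ∈ ℂ^{2^{n₁}}, φ₂ ∈ ℂ^{2^{n₂}} such that GHZ_n = φ₁ ⊗ φ₂. -/
open Matrix Complex BigOperators

noncomputable section

theorem vecCast_vkron_apply {a b c : ℕ} (h : a * b = c) (u : Fin a → ℂ) (v : Fin b → ℂ)
    (i : Fin a) (j : Fin b) (k : Fin c) (hk : (k : ℕ) = j + b * i) :
    vecCast h (vkron u v) k = u i * v j := by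
  have hk' : (finCongr h).symm k = finProdFinEquiv (i, j) := Fin.ext hk
  simp only [vecCast, vkron, hk', Equiv.symm_apply_apply]

/-- For every `n ≥ 2`, the GHZ state is globally entangled: it is not a
Kronecker product `φ₁ ⊗ φ₂` for any splitting `n = n₁ + n₂` with `n₁, n₂ ≥ 1`. -/
theorem GHZ_globally_entangled (n : ℕ) (hn : 2 ≤ n) :
    ¬ ∃ (n₁ n₂ : ℕ) (_ : 1 ≤ n₁) (_ : 1 ≤ n₂) (hsum : n₁ + n₂ = n)
        (φ₁ : Fin (2 ^ n₁) → ℂ) (φ₂ : Fin (2 ^ n₂) → ℂ),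
      GHZ n = vecCast (show 2 ^ n₁ * 2 ^ n₂ = 2 ^ n by rw [← pow_add, hsum])
        (vkron φ₁ φ₂) := by
  rintro ⟨n₁, n₂, h₁, h₂, hsum, φ₁, φ₂, h⟩
  have hprod : 2 ^ n₁ * 2 ^ n₂ = 2 ^ n := by rw [← pow_add, hsum]
  have ha : 2 ≤ 2 ^ n₁ := Nat.le_self_pow (by omega) 2
  have hb : 2 ≤ 2 ^ n₂ := Nat.le_self_pow (by omega) 2
  have hc : 2 ^ n₂ < 2 ^ n := Nat.pow_lt_pow_right (by norm_num) (by omega)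
  have hfirst : φ₁ ⟨0, by omega⟩ * φ₂ ⟨0, by omega⟩ ≠ 0 := by
    rw [← vecCast_vkron_apply hprod φ₁ φ₂ _ _ ⟨0, by omega⟩ (by simp), ← h]
    simp [GHZ]
  have hlast : φ₁ ⟨2 ^ n₁ - 1, by omega⟩ * φ₂ ⟨2 ^ n₂ - 1, by omega⟩ ≠ 0 := by
    rw [← vecCast_vkron_apply hprod φ₁ φ₂ _ _ ⟨2 ^ n - 1, by omega⟩ (by
      have : 2 ^ n₂ ≤ 2 ^ n₂ * 2 ^ n₁ := Nat.le_mul_of_pos_right _ (by omega)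
      simp only [Nat.mul_sub, mul_one]
      rw [mul_comm] at hprod
      omega), ← h]
    simp [GHZ]
  have hcross : φ₁ ⟨0, by omega⟩ * φ₂ ⟨2 ^ n₂ - 1, by omega⟩ = 0 := by
    rw [← vecCast_vkron_apply hprod φ₁ φ₂ _ _ ⟨2 ^ n₂ - 1, by omega⟩ (by simp), ← h]
    exact if_neg (by simp only; omega)
  exact mul_ne_zero (left_ne_zero_of_mul hfirst) (right_ne_zero_of_mul hlast) hcross

end
end

section
/- (Lemma 7, first part.) For all n ≥ 2, the matrix L_{2^n} := B_{2^n}† M_{2^n} B_{2^n} equals −σ_z^{⊗n}, the negative of the n-fold Kronecker power of the Pauli matrix σ_z. -/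
open Matrix Complex BigOperators

noncomputable section

theorem matCast_trans {a b c : ℕ} (h : a = b) (h' : b = c) (A : Matrix (Fin a) (Fin a) ℂ) :
    matCast h' (matCast h A) = matCast (h.trans h') A := rfl

theorem matCast_one {a b : ℕ} (h : a = b) : matCast h 1 = 1 := by
  subst h; rfl

theorem matCast_mul {a b : ℕ} (h : a = b) (A B : Matrix (Fin a) (Fin a) ℂ) :
    matCast h A * matCast h B = matCast h (A * B) := by
  subst h; rfl

theorem matCast_conjTranspose {a b : ℕ} (h : a = b) (A : Matrix (Fin a) (Fin a) ℂ) :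
    (matCast h A)ᴴ = matCast h Aᴴ := rfl

theorem kron_matCast_left {a a' b : ℕ} (h : a = a') (A : Matrix (Fin a) (Fin a) ℂ)
    (B : Matrix (Fin b) (Fin b) ℂ) :
    kron (matCast h A) B = matCast (congrArg (· * b) h) (kron A B) := by
  subst h; rfl

theorem kron_matCast_right {a b b' : ℕ} (h : b = b') (A : Matrix (Fin a) (Fin a) ℂ)
    (B : Matrix (Fin b) (Fin b) ℂ) :
    kron A (matCast h B) = matCast (congrArg (a * ·) h) (kron A B) := by
  subst h; rfl

theorem kron_mul {a b : ℕ} (A A' : Matrix (Fin a) (Fin a) ℂ) (B B' : Matrix (Fin b) (Fin b) ℂ) :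
    kron A B * kron A' B' = kron (A * A') (B * B') := by
  simp only [kron, Matrix.reindex_apply, Matrix.submatrix_mul_equiv]
  exact congrArg (·.submatrix finProdFinEquiv.symm finProdFinEquiv.symm)
    (Matrix.mul_kronecker_mul A A' B B').symm

theorem kron_one_one {a b : ℕ} :
    kron (1 : Matrix (Fin a) (Fin a) ℂ) (1 : Matrix (Fin b) (Fin b) ℂ) = 1 := by
  have h := Matrix.one_kronecker_one (α := ℂ) (m := Fin a) (n := Fin b)
  rw [kron, h, Matrix.reindex_apply, Matrix.submatrix_one_equiv]

theorem kron_conjTranspose {a b : ℕ} (A : Matrix (Fin a) (Fin a) ℂ)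
    (B : Matrix (Fin b) (Fin b) ℂ) : (kron A B)ᴴ = kron Aᴴ Bᴴ := by
  ext i j
  simp [kron]

theorem kron_assoc {a b c : ℕ} (A : Matrix (Fin a) (Fin a) ℂ) (B : Matrix (Fin b) (Fin b) ℂ)
    (C : Matrix (Fin c) (Fin c) ℂ) :
    kron (kron A B) C = matCast (mul_assoc a b c).symm (kron A (kron B C)) := by
  have key : ∀ i : Fin (a * b * c),
      finProdFinEquiv.symm (finCongr (mul_assoc a b c) i) =
        ((finProdFinEquiv.symm (finProdFinEquiv.symm i).1).1,
          finProdFinEquiv ((finProdFinEquiv.symm (finProdFinEquiv.symm i).1).2,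
            (finProdFinEquiv.symm i).2)) := by
    intro i
    rw [Equiv.symm_apply_eq]
    obtain ⟨⟨p, z⟩, rfl⟩ := finProdFinEquiv.surjective i
    obtain ⟨⟨x, y⟩, rfl⟩ := finProdFinEquiv.surjective p
    ext
    simp only [Equiv.symm_apply_apply, finCongr_apply, Fin.val_cast, finProdFinEquiv_apply_val]
    ring
  ext i j
  simp only [matCast, kron, Matrix.reindex_apply, Matrix.submatrix_apply,
    Matrix.kroneckerMap_apply, finCongr_symm, key, Equiv.symm_apply_apply, mul_assoc]

theorem kpow_succ (A : Matrix (Fin 2) (Fin 2) ℂ) (k : ℕ) :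
    kpow A (k + 1) = matCast (by rw [pow_succ, Nat.mul_comm]) (kron A (kpow A k)) := rfl

theorem kron_one_dim_right {a : ℕ} (A : Matrix (Fin a) (Fin a) ℂ) :
    kron A (1 : Matrix (Fin 1) (Fin 1) ℂ) = matCast (mul_one a).symm A := by
  ext i j
  simp [kron, matCast, finProdFinEquiv, Fin.divNat, Subsingleton.elim _ (0 : Fin 1)]
  rfl

theorem kron_one_dim_left {a : ℕ} (A : Matrix (Fin a) (Fin a) ℂ) :
    kron (1 : Matrix (Fin 1) (Fin 1) ℂ) A = matCast (one_mul a).symm A := by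
  ext i j
  have key : ∀ i : Fin (1 * a), (finProdFinEquiv.symm i).2 = finCongr (one_mul a) i := by
    intro i
    ext
    simpa [finProdFinEquiv] using Nat.mod_eq_of_lt (i.2.trans_eq (one_mul a))
  simp only [matCast, kron, Matrix.reindex_apply, Matrix.submatrix_apply,
    Matrix.kroneckerMap_apply, finCongr_symm, key]
  rw [Subsingleton.elim (finProdFinEquiv.symm i).1 (finProdFinEquiv.symm j).1,
    Matrix.one_apply_eq, one_mul]

theorem kpow_succ' (A : Matrix (Fin 2) (Fin 2) ℂ) (k : ℕ) :
    kpow A (k + 1) = matCast (pow_succ 2 k).symm (kron (kpow A k) A) := by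
  induction k with
  | zero =>
    change matCast _ (kron A (1 : Matrix (Fin 1) (Fin 1) ℂ)) =
      matCast _ (kron (1 : Matrix (Fin 1) (Fin 1) ℂ) A)
    rw [kron_one_dim_left, kron_one_dim_right]
  | succ k ih =>
    rw [kpow_succ A (k + 1)]
    nth_rw 1 [ih]
    rw [kpow_succ A k, kron_matCast_left, kron_matCast_right, kron_assoc]
    simp only [matCast_trans]

theorem kpow_mul (A B : Matrix (Fin 2) (Fin 2) ℂ) (k : ℕ) :
    kpow A k * kpow B k = kpow (A * B) k := by
  induction k with
  | zero => exact one_mul _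
  | succ k ih => simp only [kpow_succ, matCast_mul, kron_mul, ih]

theorem kpow_conjTranspose (A : Matrix (Fin 2) (Fin 2) ℂ) (k : ℕ) :
    (kpow A k)ᴴ = kpow Aᴴ k := by
  induction k with
  | zero => exact Matrix.conjTranspose_one
  | succ k ih => simp only [kpow_succ, matCast_conjTranspose, kron_conjTranspose, ih]

/-- `A ⊗ P ⊗ C`, with `A` acting on the first qubit, `C` on the last and `P` on those between. -/
def kronThree {m : ℕ} (A : Matrix (Fin 2) (Fin 2) ℂ) (P : Matrix (Fin (2 ^ m)) (Fin (2 ^ m)) ℂ)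
    (C : Matrix (Fin 2) (Fin 2) ℂ) : Matrix (Fin (2 ^ (m + 2))) (Fin (2 ^ (m + 2))) ℂ :=
  matCast (by ring) (kron A (kron P C))

section kronThree

variable {m : ℕ} (A A' C C' : Matrix (Fin 2) (Fin 2) ℂ)
  (P P' : Matrix (Fin (2 ^ m)) (Fin (2 ^ m)) ℂ)

theorem kronThree_mul :
    kronThree A P C * kronThree A' P' C' = kronThree (A * A') (P * P') (C * C') := by
  simp only [kronThree, matCast_mul, kron_mul]

theorem kronThree_conjTranspose : (kronThree A P C)ᴴ = kronThree Aᴴ Pᴴ Cᴴ := by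
  simp only [kronThree, matCast_conjTranspose, kron_conjTranspose]

theorem kronThree_zero_left : kronThree 0 P C = 0 := by
  ext i j
  simp [kronThree, matCast, kron]

theorem kronThree_add_left :
    kronThree (A + A') P C = kronThree A P C + kronThree A' P C := by
  ext i j
  simp [kronThree, matCast, kron, add_mul]

theorem kronThree_smul_left (r : ℂ) : kronThree (r • A) P C = r • kronThree A P C := by
  ext i j
  simp [kronThree, matCast, kron, mul_assoc]

theorem kronThree_smul_right (r : ℂ) : kronThree A P (r • C) = r • kronThree A P C := by
  ext i j
  simp [kronThree, matCast, kron]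
  ring

end kronThree

theorem kpow_add_two (A : Matrix (Fin 2) (Fin 2) ℂ) (m : ℕ) :
    kpow A (m + 2) = kronThree A (kpow A m) A := by
  rw [kpow_succ, kpow_succ', kron_matCast_right, matCast_trans, kronThree]

theorem Mmat_add_two (m : ℕ) : Mmat (m + 2) = kronThree σy 1 σy := rfl

theorem CNOT_add_two (m : ℕ) :
    CNOT (m + 2) = kronThree projL (1 : Matrix (Fin (2 ^ m)) (Fin (2 ^ m)) ℂ) 1 +
      kronThree projR (kpow σx m) σx := by
  have h : (1 : Matrix (Fin (2 ^ (m + 1))) (Fin (2 ^ (m + 1))) ℂ) =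
      matCast (pow_succ 2 m).symm (kron 1 1) := by rw [kron_one_one, matCast_one]
  rw [CNOT, h, kpow_succ', kron_matCast_right, kron_matCast_right, matCast_trans, matCast_trans,
    kronThree, kronThree]

theorem Bmat_add_two (m : ℕ) :
    Bmat (m + 2) = CNOT (m + 2) * kronThree H2 (kpow H2 m) 1 := by
  rw [Bmat, kpow_succ, kron_matCast_left, kron_assoc, matCast_trans, matCast_trans, kronThree]

theorem σx_conjTranspose : σxᴴ = σx := by
  ext i j
  fin_cases i <;> fin_cases j <;> simp [σx]

theorem σx_mul_σy : σx * σy = Complex.I • σz := by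
  ext i j
  fin_cases i <;> fin_cases j <;> simp [σx, σy, σz]

theorem σy_mul_σx : σy * σx = (-Complex.I) • σz := by
  ext i j
  fin_cases i <;> fin_cases j <;> simp [σx, σy, σz]

theorem H2_conj_σx : H2ᴴ * σx * H2 = σz := by
  have h : ((Real.sqrt 2 : ℝ) : ℂ) * ((Real.sqrt 2 : ℝ) : ℂ) = 2 := by
    norm_cast
    exact Real.mul_self_sqrt (by norm_num)
  have h' : ((Real.sqrt 2 : ℝ) : ℂ)⁻¹ * ((Real.sqrt 2 : ℝ) : ℂ)⁻¹ = 2⁻¹ := by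
    rw [← mul_inv, h]
  ext i j
  fin_cases i <;> fin_cases j <;>
    simp [H2, σx, σz, Matrix.mul_apply, Fin.sum_univ_two, h'] <;> norm_num

theorem CNOT_conj_Mmat (m : ℕ) :
    (CNOT (m + 2))ᴴ * Mmat (m + 2) * CNOT (m + 2) = -kronThree σx (kpow σx m) σz := by
  have hLL : projLᴴ * σy * projL = 0 := by
    ext i j
    fin_cases i <;> fin_cases j <;> simp [projL, σy, Matrix.mul_apply]
  have hRR : projRᴴ * σy * projR = 0 := by
    ext i j
    fin_cases i <;> fin_cases j <;> simp [projR, σy, Matrix.mul_apply]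
  have hLR : Complex.I • (projRᴴ * σy * projL) + (-Complex.I) • (projLᴴ * σy * projR) =
      (-1 : ℂ) • σx := by
    ext i j
    fin_cases i <;> fin_cases j <;> simp [projL, projR, σy, σx, Matrix.mul_apply]
  rw [CNOT_add_two, Mmat_add_two, Matrix.conjTranspose_add]
  simp only [kronThree_conjTranspose, add_mul, mul_add, kronThree_mul, hLL, hRR,
    kronThree_zero_left, Matrix.conjTranspose_one, one_mul, mul_one, kpow_conjTranspose,
    σx_conjTranspose, σx_mul_σy, σy_mul_σx, zero_add, add_zero]
  rw [kronThree_smul_right, kronThree_smul_right, ← kronThree_smul_left,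
    ← kronThree_smul_left, ← kronThree_add_left, hLR,
    kronThree_smul_left, neg_one_smul]

/-- Lemma 7, first part: for all `n ≥ 2`, `L_{2^n} = -σ_z^{⊗n}`. -/
theorem Lmat_eq_neg_kpow_sigmaZ (n : ℕ) (hn : 2 ≤ n) :
    Lmat n = -kpow σz n := by
  obtain ⟨m, rfl⟩ := Nat.exists_eq_add_of_le' hn
  have h : Lmat (m + 2) = (kronThree H2 (kpow H2 m) 1)ᴴ *
      ((CNOT (m + 2))ᴴ * Mmat (m + 2) * CNOT (m + 2)) * kronThree H2 (kpow H2 m) 1 := by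
    rw [Lmat, Bmat_add_two, Matrix.conjTranspose_mul]
    simp only [Matrix.mul_assoc]
  rw [h, CNOT_conj_Mmat, kronThree_conjTranspose, mul_neg, neg_mul, kronThree_mul, kronThree_mul,
    kpow_conjTranspose, kpow_mul, kpow_mul, H2_conj_σx, Matrix.conjTranspose_one, one_mul,
    mul_one, kpow_add_two]

end
end
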